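/- Recursion bound: let λ1, λ2 > 0 and H > 0 be real constants, and let f : ℕ → ℝ be a function with 0 ≤ f(i) ≤ H for all i and satisfying the recursion f(i) ≤ √(λ1 f(i+1)) + λ1 + 2^{i+1} λ2 for all i ∈ ℕ. Then f(0) ≤ 6(λ1 + λ2). -/

import Mathlib

/-- A sequence bounded above by `H` with `g i ≤ c * g (i + 1)` for some `0 ≤ c < 1`
is nonpositive. -/
theorem nonpos_of_le_mul_succ {g : ℕ → ℝ} {c H : ℝ} (hc0 : 0 ≤ c) (hc1 : c < 1)
    (hg : ∀ i, g i ≤ H) (h : ∀ i, g i ≤ c * g (i + 1)) (i : ℕ) : g i ≤ 0 := by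
  have hpow : ∀ n i, g i ≤ c ^ n * H := by
    intro n
    induction n with
    | zero => simpa using hg
    | succ n ih =>
      intro i
      calc g i ≤ c * g (i + 1) := h i
        _ ≤ c * (c ^ n * H) := mul_le_mul_of_nonneg_left (ih _) hc0
        _ = c ^ (n + 1) * H := by ring
  have hlim := (tendsto_pow_atTop_nhds_zero_of_lt_one hc0 hc1).mul_const H
  rw [zero_mul] at hlim
  exact ge_of_tendsto' hlim fun n => hpow n i

/-- A weighted AM-GM inequality. -/
theorem sqrt_mul_le_add_div_four {x y : ℝ} (hx : 0 ≤ x) (hy : 0 ≤ y) :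
    Real.sqrt (x * y) ≤ x + y / 4 := by
  rw [Real.sqrt_le_left (by positivity)]
  nlinarith [sq_nonneg (x - y / 4)]


/-- Recursion bound (Lemma 4 of Ren et al.): if `0 ≤ f i ≤ H` for all `i` and
    `f i ≤ √(λ₁ * f (i+1)) + λ₁ + 2^(i+1) * λ₂` for all `i`, with `λ₁, λ₂, H > 0`,
    then `f 0 ≤ 6 * (λ₁ + λ₂)`. -/
theorem recursion_bound (lam1 lam2 H : ℝ) (hlam1 : 0 < lam1) (hlam2 : 0 < lam2)
    (hH : 0 < H) (f : ℕ → ℝ) (hf_nonneg : ∀ i, 0 ≤ f i) (hf_le : ∀ i, f i ≤ H)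
    (hrec : ∀ i, f i ≤ Real.sqrt (lam1 * f (i + 1)) + lam1 + 2 ^ (i + 1) * lam2) :
    f 0 ≤ 6 * (lam1 + lam2) := by
  have key := nonpos_of_le_mul_succ (g := fun i => f i - 3 * lam1 - 4 * 2 ^ i * lam2)
    (c := 1 / 4) (H := H) (by norm_num) (by norm_num)
    (fun i => by
      have : 0 ≤ 4 * 2 ^ i * lam2 := by positivity
      linarith [hf_le i])
    (fun i => by
      have hr := hrec i
      have hs := sqrt_mul_le_add_div_four hlam1.le (hf_nonneg (i + 1))
      simp only [pow_succ] at hr ⊢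
      linarith) 0
  simp only [pow_zero] at key
  linarith
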